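/- Let f : ℝ^d → ℝ be differentiable with L_f-Lipschitz gradient, let r₁ : ℝ^d → ℝ be convex with every subgradient of norm at most G₁, and let r₂ : ℝ^d → ℝ be convex and differentiable with ‖∇r₂(x) − ∇r₂(y)‖ ≤ M‖x − y‖^κ for all x, y, where κ ∈ (0,1) and M > 0. Assume there exist μ > 0 and R₀ ≥ 0 such that for all x, y with ‖x − y‖ ≥ R₀ and all subgradients u₁ of r₁ at x, v₁ of r₁ at y: ⟨∇f(x) + u₁ − ∇r₂(x) − ∇f(y) − v₁ + ∇r₂(y), x − y⟩ ≥ μ‖x − y‖². Let λ > 0, γ₀ > 0 and 0 < γ ≤ γ₀. Define P(y) = prox_{γ r₁^λ}(y) and b(y) = (1/λ)(P(y) − prox_{λ r₁}(P(y))) + ∇f(P(y)) − (1/λ)(P(y) − prox_{λ r₂}(P(y))). Then for all x, y with ‖x − y‖ ≥ max{R₀, (16G₁ + 8L_f γ₀ G₁)/μ, (4M/μ)^{1/(1−κ)}}, one has ⟨b(x) − b(y), x − y⟩ ≥ (μ/2)‖x − y‖². -/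

import Mathlib

open scoped RealInnerProductSpace

/-- `u` is a subgradient of `g` at `x`. -/
def IsSubgradAt {d : ℕ} (g : EuclideanSpace ℝ (Fin d) → ℝ)
    (x u : EuclideanSpace ℝ (Fin d)) : Prop :=
  ∀ y, g x + ⟪u, y - x⟫ ≤ g y

namespace IsSubgradAt

variable {d : ℕ} {g : EuclideanSpace ℝ (Fin d) → ℝ} {x y u v : EuclideanSpace ℝ (Fin d)}

/-- The subdifferential of any function is a monotone operator. -/
lemma inner_sub_nonneg (hu : IsSubgradAt g x u) (hv : IsSubgradAt g y v) :
    0 ≤ ⟪u - v, x - y⟫ := by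
  have h1 := hu y
  have h2 := hv x
  rw [← neg_sub x y, inner_neg_right] at h1
  rw [inner_sub_left]
  linarith

/-- A subgradient at a point of differentiability is the gradient. -/
lemma eq_of_hasGradientAt (hu : IsSubgradAt g x u) (hv : HasGradientAt g v x) : u = v := by
  have hmin : IsLocalMin (fun z => g z - ⟪u, z⟫) x := Filter.Eventually.of_forall fun z => by
    have := hu z
    rw [inner_sub_right] at this
    dsimp only
    linarith
  have hd : HasFDerivAt (fun z => g z - ⟪u, z⟫)
      (InnerProductSpace.toDual ℝ _ v - InnerProductSpace.toDual ℝ _ u) x :=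
    hv.hasFDerivAt.sub (InnerProductSpace.toDual ℝ _ u).hasFDerivAt
  have h0 := hmin.hasFDerivAt_eq_zero hd
  exact ((InnerProductSpace.toDual ℝ _).injective (sub_eq_zero.1 h0)).symm

end IsSubgradAt

/-- A finite convex function on `ℝ^d` has a subgradient at every point. -/
lemma ConvexOn.exists_isSubgradAt {d : ℕ} {g : EuclideanSpace ℝ (Fin d) → ℝ}
    (hg : ConvexOn ℝ Set.univ g) (x : EuclideanSpace ℝ (Fin d)) : ∃ u, IsSubgradAt g x u := by
  have hcont : Continuous g := continuousOn_univ.1 (hg.continuousOn isOpen_univ)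
  have hopen : IsOpen {p : EuclideanSpace ℝ (Fin d) × ℝ | p.1 ∈ Set.univ ∧ g p.1 < p.2} := by
    simpa using isOpen_lt (hcont.comp continuous_fst) continuous_snd
  obtain ⟨L, hL⟩ := geometric_hahn_banach_point_open (x := (x, g x))
    hg.convex_strict_epigraph hopen (by simp)
  have hsplit : ∀ z s, L (z, s) = L (z, 0) + s * L (0, 1) := fun z s => by
    rw [← smul_eq_mul, ← map_smul, ← map_add]
    simp
  have hc : 0 < L (0, 1) := by
    have := hL (x, g x + 1) ⟨trivial, by simp⟩
    rw [hsplit x (g x), hsplit x (g x + 1)] at this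
    linarith
  set c := L (0, 1) with hc_def
  let l := L.comp (ContinuousLinearMap.inl ℝ (EuclideanSpace ℝ (Fin d)) ℝ)
  refine ⟨-(c⁻¹ • (InnerProductSpace.toDual ℝ _).symm l), fun y => ?_⟩
  have hy : L (x, 0) + g x * c ≤ L (y, 0) + g y * c := by
    refine le_of_forall_pos_lt_add fun ε hε => ?_
    have := hL (y, g y + ε / c) ⟨trivial, by simpa using div_pos hε hc⟩
    rw [hsplit x (g x), hsplit y (g y + ε / c), add_mul, div_mul_cancel₀ _ hc.ne'] at this
    linarith
  rw [inner_neg_left, inner_smul_left, InnerProductSpace.toDual_symm_apply, map_sub]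
  have e1 : l x = L (x, 0) := rfl
  have e2 : l y = L (y, 0) := rfl
  rw [e1, e2, RCLike.conj_to_real, inv_mul_eq_div, ← sub_eq_add_neg, sub_le_iff_le_add,
    ← sub_le_iff_le_add', le_div_iff₀ hc]
  linarith

/-- The gradient of a differentiable convex function is a subgradient. -/
lemma HasGradientAt.isSubgradAt {d : ℕ} {g : EuclideanSpace ℝ (Fin d) → ℝ}
    {x v : EuclideanSpace ℝ (Fin d)} (hv : HasGradientAt g v x) (hg : ConvexOn ℝ Set.univ g) :
    IsSubgradAt g x v := by
  obtain ⟨u, hu⟩ := hg.exists_isSubgradAt x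
  rwa [← hu.eq_of_hasGradientAt hv]

/-- Fermat's rule for the proximal point `p` of `x`. -/
lemma ConvexOn.isSubgradAt_of_isMinOn_prox {d : ℕ} {g : EuclideanSpace ℝ (Fin d) → ℝ}
    (hg : ConvexOn ℝ Set.univ g) {t : ℝ} (ht : 0 < t) {x p : EuclideanSpace ℝ (Fin d)}
    (hp : IsMinOn (fun y => g y + ‖x - y‖ ^ 2 / (2 * t)) Set.univ p) :
    IsSubgradAt g p ((1 / t) • (x - p)) := by
  intro z
  have key : ∀ s : ℝ, 0 < s → s ≤ 1 →
      g p + ⟪(1 / t) • (x - p), z - p⟫ - g z ≤ s * (‖z - p‖ ^ 2 / (2 * t)) := fun s hs hs1 => by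
    have h1 := isMinOn_iff.1 hp ((1 - s) • p + s • z) trivial
    have h2 := hg.2 (Set.mem_univ p) (Set.mem_univ z) (sub_nonneg.2 hs1) hs.le (by ring)
    have h3 : x - ((1 - s) • p + s • z) = (x - p) - s • (z - p) := by module
    simp only [smul_eq_mul] at h2
    rw [h3, norm_sub_sq_real (x - p), inner_smul_right, norm_smul, mul_pow, Real.norm_eq_abs,
      sq_abs] at h1
    rw [inner_smul_left, RCLike.conj_to_real]
    refine le_of_mul_le_mul_left ?_ hs
    have h4 : (‖x - p‖ ^ 2 - 2 * (s * ⟪x - p, z - p⟫) + s ^ 2 * ‖z - p‖ ^ 2) / (2 * t)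
        = ‖x - p‖ ^ 2 / (2 * t) - s * (1 / t * ⟪x - p, z - p⟫)
          + s * (s * (‖z - p‖ ^ 2 / (2 * t))) := by
      field_simp
    rw [h4] at h1
    linarith
  by_contra! hlt
  set A := g p + ⟪(1 / t) • (x - p), z - p⟫ - g z with hA
  set B := ‖z - p‖ ^ 2 / (2 * t)
  have hApos : 0 < A := by linarith
  have hB : 0 ≤ B := by positivity
  have h := key (A / (A + B)) (by positivity) ((div_le_one (by positivity)).2 (by linarith))
  rw [div_mul_eq_mul_div, le_div_iff₀ (by positivity)] at h
  nlinarith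

/-- If `a = prox_{s g}(p)` and `p = prox_{t gˢ}(x)`, with `gˢ` the Moreau envelope, then the
optimality condition `(x - p) / t = (p - a) / s` holds. -/
lemma prox_moreauEnvelope_eq {d : ℕ} {g : EuclideanSpace ℝ (Fin d) → ℝ} {s t : ℝ}
    (ht : 0 < t) {q : EuclideanSpace ℝ (Fin d) → EuclideanSpace ℝ (Fin d)}
    (hq : ∀ x, IsMinOn (fun y => g y + ‖x - y‖ ^ 2 / (2 * s)) Set.univ (q x))
    {x p : EuclideanSpace ℝ (Fin d)} (hs : 0 < s)
    (hp : IsMinOn (fun y => (⨅ z, (g z + ‖y - z‖ ^ 2 / (2 * s))) + ‖x - y‖ ^ 2 / (2 * t))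
      Set.univ p) :
    (1 / t) • (x - p) = (1 / s) • (p - q p) := by
  have hbdd : ∀ y, BddBelow (Set.range fun z => g z + ‖y - z‖ ^ 2 / (2 * s)) := fun y =>
    ⟨_, Set.forall_mem_range.2 fun z => isMinOn_iff.1 (hq y) z trivial⟩
  have hmin : IsMinOn (fun y => ‖y - q p‖ ^ 2 / (2 * s) + ‖x - y‖ ^ 2 / (2 * t)) Set.univ p :=
    isMinOn_iff.2 fun y _ => by
      have h1 := isMinOn_iff.1 hp y trivial
      have h2 := ciInf_le (hbdd y) (q p)
      have h3 : g (q p) + ‖p - q p‖ ^ 2 / (2 * s) ≤ ⨅ z, (g z + ‖p - z‖ ^ 2 / (2 * s)) :=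
        le_ciInf fun z => isMinOn_iff.1 (hq p) z trivial
      linarith
  have hgrad : ∀ y, HasGradientAt (fun y => ‖y - q p‖ ^ 2 / (2 * s)) ((1 / s) • (y - q p)) y := by
    intro y
    have h := (((hasFDerivAt_id y).sub_const (q p)).norm_sq).mul_const (2 * s)⁻¹
    refine HasFDerivAt.congr_fderiv (f' := _) h ?_
    ext z
    simp
    field_simp
  have hconv : ConvexOn ℝ Set.univ fun y => ‖y - q p‖ ^ 2 / (2 * s) := by
    have h := ((convexOn_univ_norm (E := EuclideanSpace ℝ (Fin d))).pow
      (fun _ _ => norm_nonneg _) 2).translate_left (-(q p)) |>.smul (c := (2 * s)⁻¹) (by positivity)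
    refine (by simpa [div_eq_inv_mul, sub_eq_add_neg] using h)
  exact (hconv.isSubgradAt_of_isMinOn_prox ht hmin).eq_of_hasGradientAt (hgrad p)

/-- If `p = x - t u`, `q = y - t v` and `⟪u - v, p - q⟫ ≥ 0`, then `‖p - q‖ ≤ ‖x - y‖`. -/
lemma norm_sub_le_of_inner_nonneg {E : Type*} [NormedAddCommGroup E] [InnerProductSpace ℝ E]
    {x y p q : E} {t : ℝ} (ht : 0 < t)
    (h : 0 ≤ ⟪(1 / t) • (x - p) - (1 / t) • (y - q), p - q⟫) : ‖p - q‖ ≤ ‖x - y‖ := by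
  have h1 : (1 / t) • (x - p) - (1 / t) • (y - q) = (1 / t) • ((x - y) - (p - q)) := by module
  rw [h1, inner_smul_left, RCLike.conj_to_real, inner_sub_left, real_inner_self_eq_norm_sq] at h
  have h2 := nonneg_of_mul_nonneg_right h (by positivity)
  have h3 := real_inner_le_norm (x - y) (p - q)
  by_contra! hlt
  nlinarith [norm_nonneg (x - y), norm_nonneg (p - q)]

/-- Distant dissipativity of the DC-LA drift when `r₂` is differentiable
with `(κ, M)`-Hölder continuous gradient, `κ ∈ (0,1)`. -/
theorem drift_distant_dissipative_holder {d : ℕ}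
    (f r1 r2 : EuclideanSpace ℝ (Fin d) → ℝ)
    (f' r2' : EuclideanSpace ℝ (Fin d) → EuclideanSpace ℝ (Fin d))
    (Lf G1 M kap mu R0 lam gam gam0 : ℝ)
    (hf : ∀ x, HasGradientAt f (f' x) x)
    (hLf : ∀ x y, ‖f' x - f' y‖ ≤ Lf * ‖x - y‖)
    (hr1 : ConvexOn ℝ Set.univ r1) (hr2 : ConvexOn ℝ Set.univ r2)
    (hG1 : ∀ x u, IsSubgradAt r1 x u → ‖u‖ ≤ G1)
    (hr2' : ∀ x, HasGradientAt r2 (r2' x) x)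
    (hkap : 0 < kap) (hkap1 : kap < 1) (hM : 0 < M)
    (hHolder : ∀ x y, ‖r2' x - r2' y‖ ≤ M * ‖x - y‖ ^ kap)
    (hmu : 0 < mu) (hR0 : 0 ≤ R0)
    (hdiss : ∀ x y u1 v1, R0 ≤ ‖x - y‖ →
      IsSubgradAt r1 x u1 → IsSubgradAt r1 y v1 →
      mu * ‖x - y‖ ^ 2 ≤ ⟪f' x + u1 - r2' x - f' y - v1 + r2' y, x - y⟫)
    (hlam : 0 < lam) (hgam0 : 0 < gam0) (hgam : 0 < gam) (hgamle : gam ≤ gam0)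
    (P prox1 prox2 : EuclideanSpace ℝ (Fin d) → EuclideanSpace ℝ (Fin d))
    (hP : ∀ x, IsMinOn
      (fun y => (⨅ z, (r1 z + ‖y - z‖ ^ 2 / (2 * lam))) + ‖x - y‖ ^ 2 / (2 * gam))
      Set.univ (P x))
    (hprox1 : ∀ x, IsMinOn (fun y => r1 y + ‖x - y‖ ^ 2 / (2 * lam)) Set.univ (prox1 x))
    (hprox2 : ∀ x, IsMinOn (fun y => r2 y + ‖x - y‖ ^ 2 / (2 * lam)) Set.univ (prox2 x))
    (b : EuclideanSpace ℝ (Fin d) → EuclideanSpace ℝ (Fin d))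
    (hb : ∀ y, b y = (1 / lam) • (P y - prox1 (P y)) + f' (P y)
      - (1 / lam) • (P y - prox2 (P y)))
    (x y : EuclideanSpace ℝ (Fin d))
    (hxy : max (max R0 ((16 * G1 + 8 * Lf * gam0 * G1) / mu))
        ((4 * M / mu) ^ (1 / (1 - kap))) ≤ ‖x - y‖) :
    (mu / 2) * ‖x - y‖ ^ 2 ≤ ⟪b x - b y, x - y⟫ := by
  rcases eq_or_ne x y with rfl | hne
  · simp
  set D := ‖x - y‖ with hD_def
  have hD : 0 < D := norm_pos_iff.2 (sub_ne_zero.2 hne)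
  obtain ⟨hmax, hDkap⟩ := max_le_iff.1 hxy
  obtain ⟨hDR, hDG⟩ := max_le_iff.1 hmax
  obtain ⟨u1, hu1⟩ := hr1.exists_isSubgradAt x
  obtain ⟨v1, hv1⟩ := hr1.exists_isSubgradAt y
  have hLf0 : 0 ≤ Lf := nonneg_of_mul_nonneg_left ((norm_nonneg _).trans (hLf x y)) hD
  have hG0 : 0 ≤ G1 := (norm_nonneg _).trans (hG1 x u1 hu1)
  have hsub1 : ∀ z, IsSubgradAt r1 (prox1 z) ((1 / lam) • (z - prox1 z)) := fun z =>
    hr1.isSubgradAt_of_isMinOn_prox hlam (hprox1 z)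
  have hsub2 : ∀ z, IsSubgradAt r2 (prox2 z) ((1 / lam) • (z - prox2 z)) := fun z =>
    hr2.isSubgradAt_of_isMinOn_prox hlam (hprox2 z)
  have hgrad2 : ∀ z, (1 / lam) • (z - prox2 z) = r2' (prox2 z) := fun z =>
    (hsub2 z).eq_of_hasGradientAt (hr2' _)
  have hopt : ∀ z, (1 / gam) • (z - P z) = (1 / lam) • (P z - prox1 (P z)) := fun z =>
    prox_moreauEnvelope_eq hgam hprox1 hlam (hP z)
  have hPnear : ∀ z, ‖P z - z‖ ≤ gam0 * G1 := fun z => by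
    have h := hG1 _ _ (hsub1 (P z))
    rw [← hopt, norm_smul, Real.norm_of_nonneg (by positivity), one_div_mul_eq_div,
      div_le_iff₀ hgam, norm_sub_rev] at h
    nlinarith
  have hPnonexp : ‖P x - P y‖ ≤ D := by
    refine norm_sub_le_of_inner_nonneg hgam ?_
    rw [hopt, hopt]
    set u := (1 / lam) • (P x - prox1 (P x)) with hu
    set v := (1 / lam) • (P y - prox1 (P y)) with hv
    have hsplit : P x - P y = (prox1 (P x) - prox1 (P y)) + lam • (u - v) := by
      have e : ∀ w : EuclideanSpace ℝ (Fin d), lam • (1 / lam) • w = w := fun w => by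
        rw [smul_smul, mul_one_div_cancel hlam.ne', one_smul]
      rw [smul_sub, hu, hv, e, e]
      abel
    rw [hsplit, inner_add_right, inner_smul_right, real_inner_self_eq_norm_sq]
    have := (hsub1 (P x)).inner_sub_nonneg (hsub1 (P y))
    positivity
  have hQnonexp : ‖prox2 (P x) - prox2 (P y)‖ ≤ D :=
    (norm_sub_le_of_inner_nonneg hlam
      ((hsub2 (P x)).inner_sub_nonneg (hsub2 (P y)))).trans hPnonexp
  have hmain := hdiss x y u1 v1 hDR hu1 hv1
  have hmono := ((hr2' x).isSubgradAt hr2).inner_sub_nonneg ((hr2' y).isSubgradAt hr2)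
  have hr2bound : ‖r2' (prox2 (P x)) - r2' (prox2 (P y))‖ ≤ M * D ^ kap :=
    (hHolder _ _).trans (by gcongr)
  have hfbound : ∀ z, ‖f' (P z) - f' z‖ ≤ Lf * (gam0 * G1) := fun z =>
    (hLf _ _).trans (mul_le_mul_of_nonneg_left (hPnear z) hLf0)
  have hkey : M * D ^ kap ≤ mu / 4 * D := by
    have h1 : 4 * M / mu ≤ D ^ (1 - kap) := by
      have h := Real.rpow_le_rpow (by positivity) hDkap (sub_nonneg.2 hkap1.le)
      rwa [← Real.rpow_mul (by positivity), one_div_mul_cancel (sub_pos.2 hkap1).ne',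
        Real.rpow_one] at h
    have h2 : D ^ (1 - kap) * D ^ kap = D := by
      rw [← Real.rpow_add hD, sub_add_cancel, Real.rpow_one]
    have h3 : 4 * M ≤ D ^ (1 - kap) * mu := (div_le_iff₀ hmu).1 h1
    have h4 := mul_le_mul_of_nonneg_right h3 (Real.rpow_nonneg hD.le kap)
    nlinarith
  have hGkey : 4 * G1 + 2 * (Lf * (gam0 * G1)) ≤ mu / 4 * D := by
    rw [div_le_iff₀ hmu] at hDG
    linarith
  set p := (1 / lam) • (P x - prox1 (P x))
  set q := (1 / lam) • (P y - prox1 (P y))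
  have hdecomp : b x - b y = (f' x + u1 - r2' x - f' y - v1 + r2' y) + (r2' x - r2' y)
      + ((p - u1) - (q - v1) + ((f' (P x) - f' x) - (f' (P y) - f' y))
        - (r2' (prox2 (P x)) - r2' (prox2 (P y)))) := by
    rw [hb, hb, hgrad2, hgrad2]
    abel
  set e := (p - u1) - (q - v1) + ((f' (P x) - f' x) - (f' (P y) - f' y))
        - (r2' (prox2 (P x)) - r2' (prox2 (P y))) with he_def
  have he : ‖e‖ ≤ mu / 2 * D := by
    have n1 : ‖p - u1‖ ≤ G1 + G1 :=
      (norm_sub_le _ _).trans (add_le_add (hG1 _ _ (hsub1 _)) (hG1 _ _ hu1))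
    have n2 : ‖q - v1‖ ≤ G1 + G1 :=
      (norm_sub_le _ _).trans (add_le_add (hG1 _ _ (hsub1 _)) (hG1 _ _ hv1))
    have n3 : ‖e‖ ≤ (‖p - u1‖ + ‖q - v1‖) + (‖f' (P x) - f' x‖ + ‖f' (P y) - f' y‖)
        + ‖r2' (prox2 (P x)) - r2' (prox2 (P y))‖ := by
      refine (norm_sub_le _ _).trans (add_le_add_left ?_ _)
      exact (norm_add_le _ _).trans (add_le_add (norm_sub_le _ _) (norm_sub_le _ _))
    linarith [hfbound x, hfbound y]
  have hinner := (abs_le.1 (abs_real_inner_le_norm e (x - y))).1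
  rw [hdecomp, inner_add_left, inner_add_left]
  have := mul_le_mul_of_nonneg_right he hD.le
  nlinarith
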